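/- arXiv:2601.18474 — 2 statements merged into one kernel-verified Lean document; each statement's English description precedes it below -/
import Mathlib

section
/- For every real number q such that 2q is an integer and q is not a nonpositive integer (i.e., q ∈ ½ℤ \ ℤ≤0), the set {n ∈ ℕ : n ≥ 1 and Γ^(n)(q) is transcendental} is infinite. -/
section

open Polynomial

/-- A sum `k + ∑ exp β` over a Galois-stable multiset of nonzero algebraic numbers `β`, with `k` a
nonzero integer, does not vanish. -/
theorem intCast_add_sum_exp_ne_zero {E : Type*} [Field E] [Algebra ℚ E] [FiniteDimensional ℚ E]
    [IsGalois ℚ E] (φ : E →ₐ[ℚ] ℂ) (M : Multiset E) (hM : ∀ σ : Gal(E/ℚ), M.map σ = M)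
    (h0 : (0 : E) ∉ M) {k : ℤ} (hk : k ≠ 0) :
    (k : ℂ) + (M.map fun x => Complex.exp (φ x)).sum ≠ 0 := by
  intro hsum
  have : CharZero E := algebraRat.charZero E
  have hfixed : ∀ x : E, (∀ σ : Gal(E/ℚ), σ x = x) → x ∈ Set.range (algebraMap ℚ E) := fun x hx =>
    (IsGalois.mem_range_algebraMap_iff_fixed x).2 hx
  set P : E[X] := (M.map fun x => X - C x).prod with hP
  have hPmonic : P.Monic := monic_multiset_prod_of_monic _ _ fun x _ => monic_X_sub_C x
  have hProots : P.roots = M := roots_multiset_prod_X_sub_C M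
  obtain ⟨P₀, hP₀⟩ : ∃ P₀ : ℚ[X], P₀.map (algebraMap ℚ E) = P := by
    rw [← mem_lifts, lifts_iff_coeff_lifts]
    refine fun n => hfixed _ fun σ => ?_
    have : P.map (σ : E →+* E) = P := by
      conv_rhs => rw [hP, ← hM σ]
      rw [hP, Polynomial.map_multiset_prod, Multiset.map_map, Multiset.map_map]
      simp
    conv_rhs => rw [← this]
    simp
  obtain ⟨a, ha, haf⟩ := IsLocalization.integerNormalization_spec (nonZeroDivisors ℤ) P₀
  set f : ℤ[X] := IsLocalization.integerNormalization (nonZeroDivisors ℤ) P₀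
  have ha0 : a ≠ 0 := nonZeroDivisors.ne_zero ha
  have hfE : f.map (algebraMap ℤ E) = C (a : E) * P := by
    rw [IsScalarTower.algebraMap_eq ℤ ℚ E, ← Polynomial.map_map, haf, ← hP₀]
    ext n
    simp
  have haE : (a : E) ≠ 0 := by exact_mod_cast ha0
  have hinj : Function.Injective (algebraMap ℤ E) := by
    simpa using Int.cast_injective (α := E)
  have hlead : f.leadingCoeff = a := by
    apply hinj
    rw [← leadingCoeff_map_of_injective hinj, hfE, leadingCoeff_mul, hPmonic.leadingCoeff,
      leadingCoeff_C]
    simp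
  have hfE0 : f.map (algebraMap ℤ E) ≠ 0 := by
    rw [hfE]; exact mul_ne_zero (C_ne_zero.2 haE) hPmonic.ne_zero
  have hrootsE : f.aroots E = M := by
    rw [aroots, hfE, roots_C_mul _ haE, hProots]
  have hrootsC : ∀ x ∈ M, φ x ∈ f.aroots ℂ := by
    intro x hx
    rw [← hrootsE, mem_aroots] at hx
    rw [mem_aroots]
    refine ⟨hx.1, ?_⟩
    have := congrArg φ hx.2
    rw [map_zero] at this
    rw [← this]
    simp [aeval_def, eval₂_eq_sum_range]
  have hf0 : f.eval 0 ≠ 0 := by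
    intro h
    apply h0
    rw [← hrootsE, mem_aroots]
    refine ⟨fun h => hfE0 (by simp [h]), ?_⟩
    rw [← (algebraMap ℤ E).map_zero, aeval_algebraMap_apply_eq_algebraMap_eval, h]
  obtain ⟨c, hc⟩ := LindemannWeierstrass.exp_polynomial_approx f hf0
  set d := f.natDegree
  set m := Multiset.card M
  -- integrality of the symmetric sum
  have hint : ∀ (g : ℤ[X]) (N : ℕ), g.natDegree ≤ N →
      ∃ G : ℤ, (G : ℂ) = (a : ℂ) ^ N * (M.map fun x => aeval (φ x) g).sum := by
    intro g N hN
    set s : E := (M.map fun x => (a : E) ^ N * aeval x g).sum with hs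
    have hsint : IsIntegral ℤ s := by
      refine IsIntegral.multiset_sum fun y hy => ?_
      obtain ⟨x, hx, rfl⟩ := Multiset.mem_map.1 hy
      rw [← hrootsE, mem_aroots] at hx
      have hax : IsIntegral ℤ ((a : E) * x) := by
        have := isIntegral_leadingCoeff_smul f x hx.2
        rwa [hlead, zsmul_eq_mul] at this
      rw [aeval_eq_sum_range, Finset.mul_sum]
      refine IsIntegral.sum _ fun i hi => ?_
      have hi' : i ≤ N := by
        have := Finset.mem_range.1 hi; omega
      have : (a : E) ^ N * g.coeff i • x ^ i
          = algebraMap ℤ E (a ^ (N - i) * g.coeff i) * ((a : E) * x) ^ i := by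
        rw [zsmul_eq_mul, mul_pow]
        conv_lhs => rw [← Nat.sub_add_cancel hi', pow_add]
        simp only [algebraMap_int_eq, eq_intCast, Int.cast_mul, Int.cast_pow]
        ring
      rw [this]
      exact isIntegral_algebraMap.mul (hax.pow i)
    obtain ⟨r, hr⟩ := hfixed s fun σ => by
      conv_rhs => rw [hs, ← hM σ]
      rw [hs, map_multiset_sum, Multiset.map_map, Multiset.map_map]
      congr 1
      refine Multiset.map_congr rfl fun x _ => ?_
      simp [aeval_eq_sum_range]
    rw [← hr, isIntegral_algebraMap_iff (algebraMap ℚ E).injective] at hsint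
    obtain ⟨G, hG⟩ := IsIntegrallyClosed.isIntegral_iff.1 hsint
    refine ⟨G, ?_⟩
    have h1 : φ s = (G : ℂ) := by
      rw [← hr, ← hG]; simp
    rw [← h1, hs, map_multiset_sum, Multiset.map_map, ← Multiset.sum_map_mul_left]
    congr 1
    refine Multiset.map_congr rfl fun x _ => ?_
    simp [aeval_eq_sum_range]
  -- choice of a large prime
  set B : ℝ := |(a : ℝ)| ^ d * |c| with hB
  have hlim : Filter.Tendsto (fun n : ℕ => (m : ℝ) * B * (B ^ n / (n.factorial : ℝ)))
      Filter.atTop (nhds 0) := by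
    simpa using (FloorSemiring.tendsto_pow_div_factorial_atTop B).const_mul ((m : ℝ) * B)
  obtain ⟨n₀, hn₀⟩ := Filter.eventually_atTop.1 (hlim.eventually (gt_mem_nhds one_pos))
  obtain ⟨p, hp_ge, hp⟩ := Nat.exists_infinite_primes
    (n₀ + (f.eval 0).natAbs + a.natAbs + k.natAbs + 1)
  obtain ⟨n, hpn, gp, hgp, hr⟩ := hc p (by omega) hp
  obtain ⟨G, hG⟩ := hint gp (p * d) (hgp.trans (Nat.sub_le _ _))
  have hnotdvd : ¬ (p : ℤ) ∣ a ^ (p * d) * n * k + p * G := by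
    have hp' : Prime (p : ℤ) := Nat.prime_iff_prime_int.1 hp
    rw [dvd_add_left (dvd_mul_right _ _)]
    intro h
    rcases hp'.dvd_or_dvd h with h | h
    · rcases hp'.dvd_or_dvd h with h | h
      · have := Int.natAbs_dvd_natAbs.2 (hp'.dvd_of_dvd_pow h)
        have := Nat.le_of_dvd (Int.natAbs_pos.2 ha0) this
        simp at this
        omega
      · exact hpn h
    · have := Int.natAbs_dvd_natAbs.2 h
      have := Nat.le_of_dvd (Int.natAbs_pos.2 hk) this
      simp at this
      omega
  have hne : a ^ (p * d) * n * k + p * G ≠ 0 := fun h => hnotdvd (h ▸ dvd_zero _)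
  have hge : (1 : ℝ) ≤ ‖((a ^ (p * d) * n * k + p * G : ℤ) : ℂ)‖ := by
    rw [Complex.norm_intCast]
    exact_mod_cast Int.one_le_abs hne
  have heq : ((a ^ (p * d) * n * k + p * G : ℤ) : ℂ) =
      -((a : ℂ) ^ (p * d) *
        (M.map fun x => n • Complex.exp (φ x) - p • aeval (φ x) gp).sum) := by
    rw [Multiset.sum_map_sub]
    simp only [zsmul_eq_mul, nsmul_eq_mul, Multiset.sum_map_mul_left]
    push_cast
    rw [hG, eq_neg_of_add_eq_zero_left hsum]
    ring
  have hle : ‖((a ^ (p * d) * n * k + p * G : ℤ) : ℂ)‖ ≤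
      m * B * (B ^ (p - 1) / ((p - 1).factorial : ℝ)) := by
    have hsumle : ‖(M.map fun x => n • Complex.exp (φ x) - p • aeval (φ x) gp).sum‖ ≤
        m * (|c| ^ p / ((p - 1).factorial : ℝ)) := by
      refine (norm_multiset_sum_le _).trans ?_
      rw [Multiset.map_map]
      refine (Multiset.sum_le_card_nsmul _ (|c| ^ p / ((p - 1).factorial : ℝ)) ?_).trans ?_
      · intro y hy
        obtain ⟨x, hx, rfl⟩ := Multiset.mem_map.1 hy
        refine (hr (hrootsC x hx)).trans ?_
        gcongr ?_ / _
        exact (le_abs_self _).trans (abs_pow c p).le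
      · simp [m]
    rw [heq, norm_neg, norm_mul, norm_pow, Complex.norm_intCast]
    refine (mul_le_mul_of_nonneg_left hsumle (by positivity)).trans (le_of_eq ?_)
    have : B * B ^ (p - 1) = |(a : ℝ)| ^ (p * d) * |c| ^ p := by
      rw [← pow_succ', Nat.sub_add_cancel hp.one_le, hB, mul_pow, ← pow_mul, mul_comm d p]
    rw [mul_assoc (m : ℝ) B, mul_div_assoc' B, this]
    ring
  have := hn₀ (p - 1) (by omega)
  linarith

theorem map_map_sum_powerset {A : Type*} [AddCommMonoid A] {F : Type*} [FunLike F A A]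
    [AddMonoidHomClass F A A] (σ : F) (s : Multiset A) :
    (s.powerset.map Multiset.sum).map σ = ((s.map σ).powerset).map Multiset.sum := by
  induction s using Multiset.induction with
  | empty => simp
  | cons a s ih =>
    simp only [Multiset.powerset_cons, Multiset.map_cons, Multiset.map_add, Multiset.map_map,
      Function.comp_def, Multiset.sum_cons, map_add] at ih ⊢
    rw [ih]
    congr 1
    have := congrArg (Multiset.map (fun x => σ a + x)) ih
    simpa [Multiset.map_map, Function.comp_def] using this

theorem prod_map_one_add_exp {A : Type*} [AddCommMonoid A] (φ : A →+ ℂ) (s : Multiset A) :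
    (s.map fun x => 1 + Complex.exp (φ x)).prod =
      ((s.powerset.map Multiset.sum).map fun x => Complex.exp (φ x)).sum := by
  induction s using Multiset.induction with
  | empty => simp
  | cons a s ih =>
    simp only [Multiset.powerset_cons, Multiset.map_cons, Multiset.map_add, Multiset.map_map,
      Function.comp_def, Multiset.sum_cons, map_add, Multiset.prod_cons, Multiset.sum_add,
      Complex.exp_add, Multiset.sum_map_mul_left] at ih ⊢
    rw [ih]
    ring

/-- No root of `g : ℚ[X]` in `ℂ` has exponential `-1`. -/
theorem prod_one_add_exp_aroots_ne_zero {E : Type*} [Field E] [Algebra ℚ E] (g : ℚ[X])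
    [g.IsSplittingField ℚ E] : ((g.aroots ℂ).map fun x => 1 + Complex.exp x).prod ≠ 0 := by
  have : CharZero E := algebraRat.charZero E
  have : FiniteDimensional ℚ E := IsSplittingField.finiteDimensional E g
  have : Normal ℚ E := Normal.of_isSplittingField g
  have : IsGalois ℚ E := ⟨⟩
  have hsplits := IsSplittingField.splits E g
  let φ : E →ₐ[ℚ] ℂ := IsAlgClosed.lift
  have hroots : g.aroots ℂ = (g.aroots E).map φ := by
    simpa [aroots, Polynomial.map_map] using! hsplits.roots_map (φ : E →+* ℂ)
  set S := (g.aroots E).powerset.map Multiset.sum with hS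
  have hstable : ∀ σ : Gal(E/ℚ), S.map σ = S := by
    intro σ
    have : (g.aroots E).map σ = g.aroots E := by
      have h := hsplits.roots_map (σ : E →+* E)
      rw [Polynomial.map_map, Subsingleton.elim (((σ : E →+* E)).comp (algebraMap ℚ E))
        (algebraMap ℚ E)] at h
      exact h.symm
    rw [hS, map_map_sum_powerset, this]
  classical
  set M := S.filter (· ≠ 0) with hM
  have hSM : Multiset.replicate (S.count 0) 0 + M = S := by
    rw [← Multiset.filter_eq']
    exact Multiset.filter_add_not _ _
  have hMstable : ∀ σ : Gal(E/ℚ), M.map σ = M := by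
    intro σ
    conv_rhs => rw [hM, ← hstable σ, Multiset.filter_map]
    simp [hM]
  have hcount : (S.count 0 : ℤ) ≠ 0 := by
    have : (0 : E) ∈ S := Multiset.mem_map.2 ⟨0, by simp, by simp⟩
    exact_mod_cast (Multiset.count_pos.2 this).ne'
  have hprod : ((g.aroots ℂ).map fun x => 1 + Complex.exp x).prod =
      (S.map fun x => Complex.exp (φ x)).sum := by
    rw [hroots, Multiset.map_map]
    exact prod_map_one_add_exp (φ : E →+ ℂ) (g.aroots E)
  rw [hprod, ← hSM]
  simpa using intCast_add_sum_exp_ne_zero φ M hMstable (by simp [hM]) hcount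

theorem transcendental_pi : Transcendental ℚ Real.pi := by
  intro hpi
  have hpi' : IsAlgebraic ℚ (Real.pi * Complex.I : ℂ) :=
    ((isAlgebraic_algebraMap_iff (algebraMap ℝ ℂ).injective).2 hpi).mul
      Complex.isIntegral_rat_I.isAlgebraic
  set g := minpoly ℚ (Real.pi * Complex.I : ℂ)
  refine @prod_one_add_exp_aroots_ne_zero _ _ _ g (IsSplittingField.splittingField g)
    (Multiset.prod_eq_zero (Multiset.mem_map.2 ⟨Real.pi * Complex.I, ?_, ?_⟩))
  · exact (mem_aroots (p := g)).2 ⟨minpoly.ne_zero hpi'.isIntegral, minpoly.aeval _ _⟩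
  · simp [Complex.exp_pi_mul_I]

end

theorem analyticAt_realGamma {q : ℝ} (hq : ∀ m : ℕ, q ≠ -m) : AnalyticAt ℝ Real.Gamma q := by
  have hne : Complex.Gamma q ≠ 0 := Complex.Gamma_ne_zero fun m => by exact_mod_cast hq m
  have h : AnalyticAt ℂ (fun s => (Complex.Gamma s)⁻¹⁻¹) (q : ℂ) :=
    (Complex.differentiable_one_div_Gamma.analyticAt _).inv (inv_ne_zero hne)
  simp only [inv_inv] at h
  simpa [Complex.Gamma_ofReal] using h.re_ofReal

/-- The derivatives of `Γ` at `q` span a finite-dimensional space over the real algebraic numbers. -/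
def GammaDerivsFG (q : ℝ) : Prop :=
  ∃ W : Submodule (algebraicClosure ℚ ℝ) ℝ, W.FG ∧ ∀ n, iteratedDeriv n Real.Gamma q ∈ W

theorem iteratedDeriv_Gamma_add_one {q : ℝ} (hq : ∀ m : ℕ, q ≠ -m) (n : ℕ) :
    iteratedDeriv n Real.Gamma (q + 1) =
      q * iteratedDeriv n Real.Gamma q + n * iteratedDeriv (n - 1) Real.Gamma q := by
  have hq0 : q ≠ 0 := by simpa using hq 0
  have hev : (fun x => Real.Gamma (x + 1)) =ᶠ[nhds q] fun x => Real.Gamma x * x := by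
    filter_upwards [isOpen_ne.mem_nhds hq0] with x hx
    rw [Real.Gamma_add_one hx, mul_comm]
  have h := congrFun (iteratedDeriv_comp_add_const n Real.Gamma 1) q
  rw [← h, hev.iteratedDeriv_eq, iteratedDeriv_fun_mul (analyticAt_realGamma hq).contDiffAt
    contDiffAt_fun_id]
  simp only [iteratedDeriv_fun_id]
  rcases n with _ | n
  · simp [mul_comm]
  · rw [Finset.sum_range_succ, Finset.sum_range_succ, Finset.sum_eq_zero]
    · simp [mul_comm, add_comm]
    · intro i hi
      have := Finset.mem_range.1 hi
      rw [if_neg (by omega), if_neg (by omega), mul_zero]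

theorem mul_mem_of_isAlgebraic {W : Submodule (algebraicClosure ℚ ℝ) ℝ} {a x : ℝ}
    (ha : IsAlgebraic ℚ a) (hx : x ∈ W) : a * x ∈ W :=
  W.smul_mem (⟨a, mem_algebraicClosure_iff.2 ha⟩ : algebraicClosure ℚ ℝ) hx

theorem gammaDerivsFG_add_one_iff {q : ℝ} (hq : ∀ m : ℕ, q ≠ -m) (hqa : IsAlgebraic ℚ q) :
    GammaDerivsFG (q + 1) ↔ GammaDerivsFG q := by
  have hq0 : q ≠ 0 := by simpa using hq 0
  constructor
  · rintro ⟨W, hW, hmem⟩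
    refine ⟨W, hW, fun n => ?_⟩
    induction n with
    | zero =>
      have h := hmem 0
      rw [iteratedDeriv_Gamma_add_one hq] at h
      simpa [hq0] using mul_mem_of_isAlgebraic hqa.inv h
    | succ n ih =>
      have h := hmem (n + 1)
      rw [iteratedDeriv_Gamma_add_one hq] at h
      have h' := W.sub_mem h (mul_mem_of_isAlgebraic (isAlgebraic_natCast (n + 1)) ih)
      simpa [hq0] using mul_mem_of_isAlgebraic hqa.inv h'
  · rintro ⟨W, hW, hmem⟩
    refine ⟨W, hW, fun n => ?_⟩
    rw [iteratedDeriv_Gamma_add_one hq]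
    exact W.add_mem (mul_mem_of_isAlgebraic hqa (hmem n))
      (mul_mem_of_isAlgebraic (isAlgebraic_natCast n) (hmem _))

theorem GammaDerivsFG.exists_reflection {q : ℝ} (hq : ∀ m : ℕ, q ≠ -m) (h : GammaDerivsFG q) :
    ∃ W : Submodule (algebraicClosure ℚ ℝ) ℝ, W.FG ∧
      ∀ n, iteratedDeriv n (fun x => Real.Gamma (q + x) * Real.Gamma (q - x)) 0 ∈ W := by
  obtain ⟨W, hW, hmem⟩ := h
  refine ⟨W * W, hW.mul hW, fun n => ?_⟩
  have h1 : AnalyticAt ℝ (fun x => Real.Gamma (q + x)) 0 :=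
    AnalyticAt.fun_comp (by simpa using analyticAt_realGamma hq) (by fun_prop)
  have h2 : AnalyticAt ℝ (fun x => Real.Gamma (q - x)) 0 :=
    AnalyticAt.fun_comp (by simpa using analyticAt_realGamma hq) (by fun_prop)
  rw [iteratedDeriv_fun_mul h1.contDiffAt h2.contDiffAt]
  refine Submodule.sum_mem _ fun i _ => ?_
  rw [iteratedDeriv_comp_const_add, iteratedDeriv_comp_const_sub]
  simp only [add_zero, sub_zero, smul_eq_mul]
  refine Submodule.mul_mem_mul (mul_mem_of_isAlgebraic (isAlgebraic_natCast _) (hmem _))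
    (mul_mem_of_isAlgebraic ?_ (hmem _))
  exact (isAlgebraic_one.neg).pow _

/-- If a binomial convolution `a * s = r` has `s`, `r` valued in a subfield and `s ≠ 0`, then `a` is
valued in that subfield. -/
theorem mem_of_binomial_convolution (K : Subfield ℝ) {a s r : ℕ → ℝ} {k : ℕ}
    (hs : ∀ n, s n ∈ K) (hsk : s k ≠ 0) (hlt : ∀ j < k, s j = 0) (hr : ∀ n, r n ∈ K)
    (h : ∀ n, ∑ i ∈ Finset.range (n + 1), (n.choose i : ℝ) * a i * s (n - i) = r n) (n : ℕ) :
    a n ∈ K := by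
  induction n using Nat.strong_induction_on with
  | _ n ih =>
    have hn := h (n + k)
    rw [← Finset.sum_subset (Finset.range_subset_range.2 (by omega : n + 1 ≤ n + k + 1)),
      Finset.sum_range_succ, Nat.add_sub_cancel_left] at hn
    · have hc : ((n + k).choose n : ℝ) * s k ≠ 0 :=
        mul_ne_zero (by exact_mod_cast (Nat.choose_pos (Nat.le_add_right n k)).ne') hsk
      have : a n = (r (n + k) - ∑ i ∈ Finset.range n,
          ((n + k).choose i : ℝ) * a i * s (n + k - i)) / (((n + k).choose n : ℝ) * s k) := by
        rw [eq_div_iff hc, ← hn]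
        ring
      rw [this]
      refine K.div_mem (K.sub_mem (hr _) (K.sum_mem fun i hi => ?_)) (K.mul_mem ?_ (hs _))
      · exact K.mul_mem (K.mul_mem (natCast_mem K _) (ih i (Finset.mem_range.1 hi))) (hs _)
      · exact natCast_mem K _
    · intro i hi hi'
      simp only [Finset.mem_range] at hi hi'
      rw [hlt _ (by omega), mul_zero]

theorem finite_setOf_pi_pow_mem {W : Submodule (algebraicClosure ℚ ℝ) ℝ} (hW : W.FG) :
    {n : ℕ | Real.pi ^ n ∈ W}.Finite := by
  have : Algebra.IsAlgebraic ℚ (algebraicClosure ℚ ℝ) := algebraicClosure.isAlgebraic ℚ ℝ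
  have htr : Transcendental (algebraicClosure ℚ ℝ) Real.pi := transcendental_pi.extendScalars _
  have hli : LinearIndependent (algebraicClosure ℚ ℝ) fun n : ℕ => Real.pi ^ n := by
    have := (Polynomial.basisMonomials (algebraicClosure ℚ ℝ)).linearIndependent.map'
      (Polynomial.aeval Real.pi).toLinearMap (LinearMap.ker_eq_bot.2
        (transcendental_iff_injective.1 htr))
    simpa [Function.comp_def] using this
  have : Module.Finite (algebraicClosure ℚ ℝ) W := Module.Finite.iff_fg.2 hW
  have hli' : LinearIndependent (algebraicClosure ℚ ℝ)
      fun n : {n : ℕ | Real.pi ^ n ∈ W} => (⟨Real.pi ^ (n : ℕ), n.2⟩ : W) :=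
    LinearIndependent.of_comp W.subtype (hli.comp _ Subtype.val_injective)
  exact Set.finite_coe_iff.1 hli'.finite

theorem not_fg_of_mul_comp_pi_mul {W : Submodule (algebraicClosure ℚ ℝ) ℝ} (hW : W.FG)
    {h s r : ℝ → ℝ} (hh : AnalyticAt ℝ h 0) (hmem : ∀ n, iteratedDeriv n h 0 ∈ W)
    (hs : AnalyticOnNhd ℝ s Set.univ) (hr : AnalyticOnNhd ℝ r Set.univ)
    (hsa : ∀ n, IsAlgebraic ℚ (iteratedDeriv n s 0))
    (hra : ∀ n, IsAlgebraic ℚ (iteratedDeriv n r 0))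
    {k : ℕ} (hsk : iteratedDeriv k s 0 ≠ 0) (hlt : ∀ j < k, iteratedDeriv j s 0 = 0)
    {y e : ℝ} (hsy : s y = 0) (hry : r y ≠ 0) (he : e ≠ 0)
    (heq : ∀ᶠ x in nhds 0, h x * s (Real.pi * x) = e * r (Real.pi * x)) : False := by
  have hpi := Real.pi_ne_zero
  have hsc : ContDiff ℝ ⊤ s := contDiff_iff_contDiffAt.2 fun x => (hs x trivial).contDiffAt
  have hrc : ContDiff ℝ ⊤ r := contDiff_iff_contDiffAt.2 fun x => (hr x trivial).contDiffAt
  have hs' : AnalyticOnNhd ℝ (fun x => s (Real.pi * x)) Set.univ := fun x _ =>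
    AnalyticAt.fun_comp (hs _ trivial) (by fun_prop)
  have hr' : AnalyticOnNhd ℝ (fun x => e * r (Real.pi * x)) Set.univ := fun x _ =>
    analyticAt_const.mul (AnalyticAt.fun_comp (hr _ trivial) (by fun_prop))
  -- the Taylor coefficients of `h` are algebraic multiples of `e * π ^ n`
  have halg : ∀ n, IsAlgebraic ℚ (iteratedDeriv n h 0 / (e * Real.pi ^ n)) := by
    intro n
    rw [← mem_algebraicClosure_iff]
    refine mem_of_binomial_convolution (algebraicClosure ℚ ℝ).toSubfield
      (s := fun n => iteratedDeriv n s 0) (r := fun n => iteratedDeriv n r 0)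
      (a := fun n => iteratedDeriv n h 0 / (e * Real.pi ^ n)) (k := k)
      (fun n => mem_algebraicClosure_iff.2 (hsa n)) hsk hlt
      (fun n => mem_algebraicClosure_iff.2 (hra n)) (fun n => ?_) n
    have h1 := Filter.EventuallyEq.iteratedDeriv_eq n heq
    rw [iteratedDeriv_fun_mul hh.contDiffAt (hs' 0 trivial).contDiffAt,
      iteratedDeriv_const_mul_field, iteratedDeriv_comp_const_mul (hrc.of_le le_top)] at h1
    have h2 : iteratedDeriv n r 0 =
        (e * (Real.pi ^ n * iteratedDeriv n r (Real.pi * 0))) / (e * Real.pi ^ n) := by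
      rw [mul_zero]
      field_simp
    rw [h2, ← h1, Finset.sum_div]
    refine Finset.sum_congr rfl fun i hi => ?_
    have hi' : i ≤ n := Nat.lt_succ_iff.1 (Finset.mem_range.1 hi)
    rw [iteratedDeriv_comp_const_mul (hsc.of_le le_top)]
    simp only [mul_zero]
    have hp : Real.pi ^ n = Real.pi ^ i * Real.pi ^ (n - i) := by
      rw [← pow_add, Nat.add_sub_cancel' hi']
    rw [hp]
    field_simp
  -- all but finitely many Taylor coefficients of `h` vanish
  have hfin : {n : ℕ | iteratedDeriv n h 0 ≠ 0}.Finite := by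
    have hW' : (Submodule.span (algebraicClosure ℚ ℝ) {e⁻¹} * W).FG :=
      (Submodule.fg_span_singleton _).mul hW
    refine (finite_setOf_pi_pow_mem hW').subset fun n hn => ?_
    have : Real.pi ^ n =
        e⁻¹ * ((iteratedDeriv n h 0 / (e * Real.pi ^ n))⁻¹ * iteratedDeriv n h 0) := by
      have hn' : iteratedDeriv n h 0 ≠ 0 := hn
      field_simp
    rw [Set.mem_ofPred_eq, this]
    exact Submodule.mul_mem_mul (Submodule.mem_span_singleton_self _)
      (mul_mem_of_isAlgebraic (halg n).inv (hmem n))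
  have hpoly : ∀ᶠ x in nhds 0,
      h x = ∑ n ∈ hfin.toFinset, iteratedDeriv n h 0 / n.factorial * x ^ n := by
    filter_upwards [hh.hasFPowerSeriesAt.eventually_hasSum] with x hx
    rw [zero_add] at hx
    refine hx.unique ?_
    have := hasSum_sum_of_ne_finset_zero (s := hfin.toFinset) (L := SummationFilter.unconditional ℕ)
      (f := fun n => iteratedDeriv n h 0 / (n.factorial : ℝ) * x ^ n) (fun n hn => by
        have : iteratedDeriv n h 0 = 0 := by simpa using hn
        simp [this])
    simpa [FormalMultilinearSeries.ofScalars_apply_eq, mul_comm] using this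
  have hglob : (fun x => (∑ n ∈ hfin.toFinset, iteratedDeriv n h 0 / n.factorial * x ^ n) *
      s (Real.pi * x)) = fun x => e * r (Real.pi * x) := by
    refine AnalyticOnNhd.eq_of_eventuallyEq (z₀ := 0) (AnalyticOnNhd.mul ?_ hs') hr' ?_
    · intro x _
      fun_prop
    · filter_upwards [heq, hpoly] with x hx hx'
      rw [← hx, ← hx']
  have := congrFun hglob (y / Real.pi)
  simp only [mul_div_cancel₀ y hpi, hsy, mul_zero] at this
  exact mul_ne_zero he hry this.symm

theorem isAlgebraic_iteratedDeriv_sin_cos (n : ℕ) :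
    IsAlgebraic ℚ (iteratedDeriv n Real.sin 0) ∧ IsAlgebraic ℚ (iteratedDeriv n Real.cos 0) := by
  induction n with
  | zero => simp [isAlgebraic_zero, isAlgebraic_one]
  | succ n ih =>
    rw [iteratedDeriv_succ', iteratedDeriv_succ', Real.deriv_sin, Real.deriv_cos',
      iteratedDeriv_fun_neg]
    exact ⟨ih.2, ih.1.neg⟩

theorem not_gammaDerivsFG_one : ¬ GammaDerivsFG 1 := by
  intro h
  have h1 : ∀ m : ℕ, (1 : ℝ) ≠ -m := fun m => by
    have : (0 : ℝ) ≤ m := m.cast_nonneg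
    linarith
  obtain ⟨W, hW, hmem⟩ := h.exists_reflection h1
  refine not_fg_of_mul_comp_pi_mul (s := Real.sin) (r := fun x => x) (k := 1) (y := Real.pi)
    (e := 1) hW ?_ hmem Real.analyticOnNhd_sin analyticOnNhd_id
    (fun n => (isAlgebraic_iteratedDeriv_sin_cos n).1) (fun n => ?_) (by simp) (fun j hj => ?_)
    Real.sin_pi Real.pi_ne_zero one_ne_zero ?_
  · exact (AnalyticAt.fun_comp (by simpa using analyticAt_realGamma h1) (by fun_prop)).mul
      (AnalyticAt.fun_comp (by simpa using analyticAt_realGamma h1) (by fun_prop))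
  · rw [iteratedDeriv_fun_id_zero]
    split_ifs
    exacts [isAlgebraic_one, isAlgebraic_zero]
  · obtain rfl : j = 0 := by omega
    simp
  · filter_upwards [Ioo_mem_nhds (neg_one_lt_zero) (one_pos : (0 : ℝ) < 1)] with x hx
    by_cases hx0 : x = 0
    · simp [hx0]
    have hsin : Real.sin (Real.pi * x) ≠ 0 := by
      rw [Ne, mul_comm, Real.sin_eq_zero_iff_of_lt_of_lt]
      · exact mul_ne_zero hx0 Real.pi_ne_zero
      · nlinarith [hx.1, Real.pi_pos]
      · nlinarith [hx.2, Real.pi_pos]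
    rw [add_comm, Real.Gamma_add_one hx0, mul_assoc x, Real.Gamma_mul_Gamma_one_sub, one_mul,
      mul_assoc, div_mul_cancel₀ _ hsin, mul_comm]

theorem not_gammaDerivsFG_one_half : ¬ GammaDerivsFG (1 / 2) := by
  intro h
  have h1 : ∀ m : ℕ, (1 / 2 : ℝ) ≠ -m := fun m => by
    have : (0 : ℝ) ≤ m := m.cast_nonneg
    linarith
  obtain ⟨W, hW, hmem⟩ := h.exists_reflection h1
  refine not_fg_of_mul_comp_pi_mul (s := Real.cos) (r := fun _ => 1) (k := 0) (y := Real.pi / 2)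
    (e := Real.pi) hW ?_ hmem Real.analyticOnNhd_cos analyticOnNhd_const
    (fun n => (isAlgebraic_iteratedDeriv_sin_cos n).2) (fun n => ?_) (by simp) (by simp)
    Real.cos_pi_div_two one_ne_zero Real.pi_ne_zero ?_
  · exact (AnalyticAt.fun_comp (by simpa using analyticAt_realGamma h1) (by fun_prop)).mul
      (AnalyticAt.fun_comp (by simpa using analyticAt_realGamma h1) (by fun_prop))
  · rw [iteratedDeriv_const]
    split_ifs
    exacts [isAlgebraic_one, isAlgebraic_zero]
  · filter_upwards [Ioo_mem_nhds (by norm_num : (-1 / 2 : ℝ) < 0) (by norm_num : (0 : ℝ) < 1 / 2)]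
      with x hx
    have hcos : Real.cos (Real.pi * x) ≠ 0 := by
      refine (Real.cos_pos_of_mem_Ioo ⟨?_, ?_⟩).ne'
      · nlinarith [hx.1, Real.pi_pos]
      · nlinarith [hx.2, Real.pi_pos]
    have := Real.Gamma_mul_Gamma_one_sub (1 / 2 + x)
    rw [show (1 : ℝ) - (1 / 2 + x) = 1 / 2 - x by ring,
      show Real.pi * (1 / 2 + x) = Real.pi * x + Real.pi / 2 by ring, Real.sin_add_pi_div_two]
      at this
    rw [this]
    field_simp

theorem not_gammaDerivsFG_natCast_add_one (n : ℕ) : ¬ GammaDerivsFG (n + 1) := by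
  induction n with
  | zero => simpa using not_gammaDerivsFG_one
  | succ n ih =>
    have hne (m : ℕ) : (n + 1 : ℝ) ≠ -m := by
      have : (0 : ℝ) ≤ m := m.cast_nonneg
      have : (0 : ℝ) ≤ n := n.cast_nonneg
      linarith
    have halg : IsAlgebraic ℚ (n + 1 : ℝ) := (isAlgebraic_natCast n).add isAlgebraic_one
    rw [Nat.cast_succ, gammaDerivsFG_add_one_iff hne halg]
    exact ih

theorem not_gammaDerivsFG_intCast_add_one_half (n : ℤ) : ¬ GammaDerivsFG (n + 1 / 2) := by
  have hne (n : ℤ) (m : ℕ) : (n + 1 / 2 : ℝ) ≠ -m := by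
    intro h
    have : ((2 * (n + m) + 1 : ℤ) : ℝ) = 0 := by
      push_cast
      linarith
    have : 2 * (n + m) + 1 = 0 := by exact_mod_cast this
    omega
  have hstep (n : ℤ) : GammaDerivsFG ((n + 1 : ℤ) + 1 / 2) ↔ GammaDerivsFG (n + 1 / 2) := by
    have halg : IsAlgebraic ℚ (n + 1 / 2 : ℝ) := by
      have := isAlgebraic_algebraMap (R := ℚ) (A := ℝ) (n + 1 / 2)
      simpa using this
    rw [← gammaDerivsFG_add_one_iff (hne n) halg]
    push_cast
    rw [add_right_comm]
  induction n using Int.induction_on with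
  | zero => simpa using not_gammaDerivsFG_one_half
  | succ n ih => rwa [hstep]
  | pred n ih => rwa [← hstep, sub_add_cancel]

theorem gammaDerivsFG_of_finite {q : ℝ}
    (h : {n : ℕ | 1 ≤ n ∧ Transcendental ℚ (iteratedDeriv n Real.Gamma q)}.Finite) :
    GammaDerivsFG q := by
  set S : Set ℕ := insert 0 {n : ℕ | 1 ≤ n ∧ Transcendental ℚ (iteratedDeriv n Real.Gamma q)}
  refine ⟨Submodule.span _ (insert 1 ((fun n => iteratedDeriv n Real.Gamma q) '' S)),
    Submodule.fg_span (((h.insert 0).image _).insert 1), fun n => ?_⟩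
  by_cases hn : n ∈ S
  · exact Submodule.subset_span (Set.mem_insert_of_mem _ (Set.mem_image_of_mem _ hn))
  · have halg : IsAlgebraic ℚ (iteratedDeriv n Real.Gamma q) := by
      by_contra hc
      exact hn (Set.mem_insert_iff.2 (n.eq_zero_or_pos.imp id fun h => ⟨h, hc⟩))
    simpa using mul_mem_of_isAlgebraic halg (Submodule.subset_span (Set.mem_insert 1 _))

/-- For every real number `q` with `2q ∈ ℤ` and `q` not a nonpositive integer,
the set of `n ≥ 1` for which the `n`-th derivative of the Gamma function at `q`
is transcendental is infinite. -/
theorem gamma_deriv_transcendental_infinitely_often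
    (q : ℝ) (hq : ∃ k : ℤ, 2 * q = (k : ℝ))
    (hq' : ¬ ∃ k : ℤ, k ≤ 0 ∧ q = (k : ℝ)) :
    {n : ℕ | 1 ≤ n ∧ Transcendental ℚ (iteratedDeriv n Real.Gamma q)}.Infinite := by
  intro hfin
  have hFG := gammaDerivsFG_of_finite hfin
  obtain ⟨k, hk⟩ := hq
  obtain ⟨j, rfl | rfl⟩ := k.even_or_odd'
  · have hqj : q = j := by
      push_cast at hk
      linarith
    have hj : 0 < j := by
      by_contra hj
      exact hq' ⟨j, not_lt.1 hj, hqj⟩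
    obtain ⟨n, rfl⟩ : ∃ n : ℕ, j = n + 1 := ⟨(j - 1).toNat, by omega⟩
    refine not_gammaDerivsFG_natCast_add_one n ?_
    simpa [hqj] using hFG
  · have hqj : q = j + 1 / 2 := by
      push_cast at hk
      linarith
    exact not_gammaDerivsFG_intCast_add_one_half j (hqj ▸ hFG)
end

section
/- Let q be a real number with 2q ∈ ℤ and q not a nonpositive integer, and set ε = 0 if q ∈ ℤ and ε = 1 otherwise. Then for every natural number j there exist real algebraic numbers e_0, e_1, …, e_j with e_j ≠ 0 such that ∑_{i=0}^{2j} (−1)^i · Γ^(i)(q) · Γ^(2j−i)(q) / (i! · (2j−i)!) = ∑_{k=0}^{j} e_k · π^(2k+ε). -/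
open Real
open scoped Classical

namespace PowerSeries

/-- If `g` has zero coefficients in degrees `0` and `1` and solves `X g' = X² + c g + g²` with
`c ≤ 1`, then all of its coefficients are nonnegative and the one of `X²` is positive. -/
theorem coeff_nonneg_of_riccati {g : ℚ⟦X⟧} {c : ℚ} (hc : c ≤ 1) (h0 : coeff 0 g = 0)
    (h1 : coeff 1 g = 0) (hg : X * d⁄dX ℚ g = X ^ 2 + C c * g + g * g) :
    (∀ n, 0 ≤ coeff n g) ∧ 0 < coeff 2 g := by
  have hrec (n : ℕ) : ((n : ℚ) + 2 - c) * coeff (n + 2) g =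
      (if n = 0 then 1 else 0) +
        ∑ p ∈ Finset.HasAntidiagonal.antidiagonal (n + 2), coeff p.1 g * coeff p.2 g := by
    have h := congrArg (coeff (n + 2)) hg
    rw [show n + 2 = (n + 1) + 1 from rfl, coeff_succ_X_mul, coeff_derivative, map_add, map_add,
      coeff_C_mul, coeff_mul, coeff_X_pow] at h
    simp only [Nat.reduceEqDiff] at h
    push_cast at h
    linarith
  have hnonneg (n : ℕ) : 0 ≤ coeff n g := by
    induction n using Nat.strong_induction_on with
    | _ n ih =>
      match n with
      | 0 => exact h0.ge
      | 1 => exact h1.ge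
      | n + 2 =>
        have hsum : 0 ≤ ∑ p ∈ Finset.HasAntidiagonal.antidiagonal (n + 2), coeff p.1 g * coeff p.2 g := by
          refine Finset.sum_nonneg fun p hp => ?_
          rw [Finset.HasAntidiagonal.mem_antidiagonal] at hp
          rcases Nat.eq_zero_or_pos p.1 with h | h
          · rw [h, h0, zero_mul]
          rcases Nat.eq_zero_or_pos p.2 with h' | h'
          · rw [h', h0, mul_zero]
          exact mul_nonneg (ih _ (by omega)) (ih _ (by omega))
        have hpos : (0 : ℚ) < n + 2 - c := by
          have : (0 : ℚ) ≤ n := n.cast_nonneg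
          linarith
        refine nonneg_of_mul_nonneg_right ?_ hpos
        rw [hrec]
        split_ifs <;> linarith
  refine ⟨hnonneg, ?_⟩
  have hpos : (0 : ℚ) < (0 : ℕ) + 2 - c := by push_cast; linarith
  refine pos_of_mul_pos_right ?_ hpos.le
  rw [hrec 0, if_pos rfl]
  have := Finset.sum_nonneg fun p (_ : p ∈ Finset.HasAntidiagonal.antidiagonal (0 + 2)) =>
    mul_nonneg (hnonneg p.1) (hnonneg p.2)
  linarith

/-- If `X f' = f g` with `f 0 > 0`, where `g` has nonnegative coefficients, vanishing constant
term and positive coefficient of `X²`, then the even coefficients of `f` are positive. -/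
theorem coeff_even_pos_of_log_derivative {f g : ℚ⟦X⟧} (hf : 0 < coeff 0 f) (h0 : coeff 0 g = 0)
    (hg : ∀ n, 0 ≤ coeff n g) (h2 : 0 < coeff 2 g) (hfg : X * d⁄dX ℚ f = f * g) (j : ℕ) :
    0 < coeff (2 * j) f := by
  have hrec (n : ℕ) : ((n : ℚ) + 1) * coeff (n + 1) f =
      ∑ p ∈ Finset.HasAntidiagonal.antidiagonal (n + 1), coeff p.1 f * coeff p.2 g := by
    have h := congrArg (coeff (n + 1)) hfg
    rw [coeff_succ_X_mul, coeff_derivative, coeff_mul] at h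
    linarith
  have hnonneg (n : ℕ) : 0 ≤ coeff n f := by
    induction n using Nat.strong_induction_on with
    | _ n ih =>
      match n with
      | 0 => exact hf.le
      | n + 1 =>
        refine nonneg_of_mul_nonneg_right ?_ (by positivity : (0 : ℚ) < (n : ℚ) + 1)
        rw [hrec]
        refine Finset.sum_nonneg fun p hp => ?_
        rw [Finset.HasAntidiagonal.mem_antidiagonal] at hp
        rcases Nat.eq_zero_or_pos p.2 with h | h
        · rw [h, h0, mul_zero]
        exact mul_nonneg (ih _ (by omega)) (hg _)
  induction j with
  | zero => exact hf
  | succ j ih =>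
    refine pos_of_mul_pos_right ?_ (by positivity : (0 : ℚ) ≤ ((2 * j + 1 : ℕ) : ℚ) + 1)
    rw [show 2 * (j + 1) = 2 * j + 1 + 1 by ring, hrec]
    exact Finset.sum_pos' (fun p _ => mul_nonneg (hnonneg _) (hg _))
      ⟨(2 * j, 2), by simp, mul_pos ih h2⟩

theorem derivative_sin : d⁄dX ℚ (PowerSeries.sin ℚ) = PowerSeries.cos ℚ := by
  ext n
  rw [coeff_derivative]
  rcases Nat.even_or_odd' n with ⟨m, rfl | rfl⟩
  · have h : (2 * m + 1) / 2 = m := by omega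
    simp [PowerSeries.sin, PowerSeries.cos, h, Nat.factorial_succ]
    field_simp
  · have h : Even (2 * m + 1 + 1) := ⟨m + 1, by ring⟩
    simp [PowerSeries.sin, PowerSeries.cos, h]

theorem derivative_cos : d⁄dX ℚ (PowerSeries.cos ℚ) = -PowerSeries.sin ℚ := by
  ext n
  rw [coeff_derivative]
  rcases Nat.even_or_odd' n with ⟨m, rfl | rfl⟩
  · simp [PowerSeries.sin, PowerSeries.cos]
  · have h : Even (2 * m + 1 + 1) := ⟨m + 1, by ring⟩
    have h1 : (2 * m + 1 + 1) / 2 = m + 1 := by omega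
    have h2 : (2 * m + 1) / 2 = m := by omega
    simp [PowerSeries.sin, PowerSeries.cos, h, h1, h2, Nat.factorial_succ, pow_succ]
    field_simp

/-- The power series of `sin x / x`. -/
noncomputable def sinc : ℚ⟦X⟧ :=
  mk fun n => coeff (n + 1) (PowerSeries.sin ℚ)

theorem X_mul_sinc : X * sinc = PowerSeries.sin ℚ := by
  ext n
  cases n with
  | zero => simp [PowerSeries.sin]
  | succ n => rw [coeff_succ_X_mul, sinc, coeff_mk]

theorem constantCoeff_sinc : constantCoeff sinc = 1 := by
  rw [← coeff_zero_eq_constantCoeff_apply]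
  simp [sinc, PowerSeries.sin]

theorem constantCoeff_cos : constantCoeff (PowerSeries.cos ℚ) = 1 := by
  rw [← coeff_zero_eq_constantCoeff_apply]
  simp [PowerSeries.cos]

theorem coeff_eq_zero_of_evalNegHom_eq {f : ℚ⟦X⟧} (hf : evalNegHom f = f) {n : ℕ} (hn : Odd n) :
    coeff n f = 0 := by
  have h := congrArg (coeff n) hf
  rw [evalNegHom, coeff_rescale, hn.neg_one_pow] at h
  linarith

theorem evalNegHom_inv {f : ℚ⟦X⟧} (h0 : constantCoeff f ≠ 0) (hf : evalNegHom f = f) :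
    evalNegHom f⁻¹ = f⁻¹ := by
  have h : evalNegHom (f * f⁻¹) = 1 := by rw [PowerSeries.mul_inv_cancel f h0, map_one]
  rw [map_mul, hf] at h
  exact ((PowerSeries.inv_eq_iff_mul_eq_one h0).2 (by rw [mul_comm, h])).symm

theorem evalNegHom_cos : evalNegHom (PowerSeries.cos ℚ) = PowerSeries.cos ℚ := by
  ext n
  rw [evalNegHom, coeff_rescale]
  rcases Nat.even_or_odd n with h | h
  · rw [h.neg_one_pow, one_mul]
  · simp [PowerSeries.cos, Nat.not_even_iff_odd.2 h]

theorem evalNegHom_sinc : evalNegHom sinc = sinc := by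
  ext n
  rw [evalNegHom, coeff_rescale]
  rcases Nat.even_or_odd n with h | h
  · rw [h.neg_one_pow, one_mul]
  · simp [sinc, PowerSeries.sin, h.add_one]

theorem coeff_even_inv_cos_pos (j : ℕ) : 0 < coeff (2 * j) (PowerSeries.cos ℚ)⁻¹ := by
  set s := (PowerSeries.cos ℚ)⁻¹ with hs
  have hcs : PowerSeries.cos ℚ * s = 1 :=
    PowerSeries.mul_inv_cancel _ (by simp [constantCoeff_cos])
  have hds : d⁄dX ℚ s = s * (PowerSeries.sin ℚ * s) := by
    rw [hs, derivative_inv', derivative_cos]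
    ring
  have hdt : d⁄dX ℚ (PowerSeries.sin ℚ * s) =
      1 + (PowerSeries.sin ℚ * s) * (PowerSeries.sin ℚ * s) := by
    rw [Derivation.leibniz, hds, derivative_sin, smul_eq_mul, smul_eq_mul]
    linear_combination hcs
  have h0 : coeff 0 (X * (PowerSeries.sin ℚ * s)) = 0 := by simp
  have h1 : coeff 1 (X * (PowerSeries.sin ℚ * s)) = 0 := by
    rw [show (1 : ℕ) = 0 + 1 from rfl, coeff_succ_X_mul]
    simp [← X_mul_sinc]
  have hg : X * d⁄dX ℚ (X * (PowerSeries.sin ℚ * s)) =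
      X ^ 2 + C 1 * (X * (PowerSeries.sin ℚ * s)) +
        X * (PowerSeries.sin ℚ * s) * (X * (PowerSeries.sin ℚ * s)) := by
    rw [Derivation.leibniz, hdt, derivative_X, smul_eq_mul, smul_eq_mul, map_one]
    ring
  obtain ⟨hnn, h2⟩ := coeff_nonneg_of_riccati le_rfl h0 h1 hg
  refine coeff_even_pos_of_log_derivative ?_ h0 hnn h2 (by rw [hds]; ring) j
  simp [hs, constantCoeff_cos]

theorem coeff_even_inv_sinc_pos (j : ℕ) : 0 < coeff (2 * j) sinc⁻¹ := by
  set f := sinc⁻¹ with hf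
  have hsf : sinc * f = 1 := PowerSeries.mul_inv_cancel _ (by simp [constantCoeff_sinc])
  have hds : sinc + X * d⁄dX ℚ sinc = PowerSeries.cos ℚ := by
    rw [← derivative_sin, ← X_mul_sinc, Derivation.leibniz, derivative_X, smul_eq_mul,
      smul_eq_mul]
    ring
  have hdf : X * d⁄dX ℚ f = f * (1 - PowerSeries.cos ℚ * f) := by
    rw [hf, derivative_inv', ← hf]
    linear_combination (-f ^ 2) * hds + f * hsf
  have hg : X * d⁄dX ℚ (1 - PowerSeries.cos ℚ * f) =
      X ^ 2 + C (-1) * (1 - PowerSeries.cos ℚ * f) +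
        (1 - PowerSeries.cos ℚ * f) * (1 - PowerSeries.cos ℚ * f) := by
    rw [map_sub, derivative_one, Derivation.leibniz, derivative_cos, smul_eq_mul, smul_eq_mul,
      map_neg, map_one]
    linear_combination (-PowerSeries.cos ℚ) * hdf - X * f * X_mul_sinc + X ^ 2 * hsf
  have hev : evalNegHom (1 - PowerSeries.cos ℚ * f) = 1 - PowerSeries.cos ℚ * f := by
    rw [map_sub, map_one, map_mul, evalNegHom_cos,
      evalNegHom_inv (by simp [constantCoeff_sinc]) evalNegHom_sinc]
  have h0 : coeff 0 (1 - PowerSeries.cos ℚ * f) = 0 := by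
    simp [hf, constantCoeff_cos, constantCoeff_sinc]
  obtain ⟨hnn, h2⟩ := coeff_nonneg_of_riccati (by norm_num) h0
    (coeff_eq_zero_of_evalNegHom_eq hev odd_one) hg
  refine coeff_even_pos_of_log_derivative ?_ h0 hnn h2 hdf j
  simp [hf, constantCoeff_sinc]

/-- The Taylor series of a real function at `0`. -/
noncomputable def taylorAtZero (f : ℝ → ℝ) : ℝ⟦X⟧ :=
  mk fun n => iteratedDeriv n f 0 / (n.factorial : ℝ)

theorem taylorAtZero_congr {f g : ℝ → ℝ} (h : f =ᶠ[nhds 0] g) :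
    taylorAtZero f = taylorAtZero g := by
  ext n
  simp only [taylorAtZero, coeff_mk, h.iteratedDeriv_eq n]

theorem taylorAtZero_mul {f g : ℝ → ℝ} (hf : ∀ n : ℕ, ContDiffAt ℝ n f 0)
    (hg : ∀ n : ℕ, ContDiffAt ℝ n g 0) :
    taylorAtZero (fun t => f t * g t) = taylorAtZero f * taylorAtZero g := by
  ext n
  rw [coeff_mul, Finset.Nat.sum_antidiagonal_eq_sum_range_succ_mk]
  simp only [taylorAtZero, coeff_mk]
  rw [iteratedDeriv_fun_mul (hf n) (hg n), Finset.sum_div]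
  refine Finset.sum_congr rfl fun i hi => ?_
  rw [Nat.cast_choose ℝ (Nat.lt_succ_iff.1 (Finset.mem_range.1 hi))]
  field_simp

theorem taylorAtZero_const (c : ℝ) : taylorAtZero (fun _ => c) = C c := by
  ext n
  rcases n with _ | n <;> simp [taylorAtZero, iteratedDeriv_const, coeff_C]

theorem taylorAtZero_const_add (c : ℝ) : taylorAtZero (fun t => c + t) = C c + X := by
  ext n
  rcases n with _ | _ | n <;>
    simp [taylorAtZero, iteratedDeriv_succ', iteratedDeriv_const, coeff_X]

theorem taylorAtZero_const_sub (c : ℝ) : taylorAtZero (fun t => c - t) = C c - X := by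
  ext n
  rcases n with _ | _ | n <;>
    simp [taylorAtZero, iteratedDeriv_succ', iteratedDeriv_const, coeff_X]

theorem taylorAtZero_comp_const_mul {f : ℝ → ℝ} (hf : ∀ n : ℕ, ContDiff ℝ n f) (c : ℝ) :
    taylorAtZero (fun t => f (c * t)) = rescale c (taylorAtZero f) := by
  ext n
  simp only [taylorAtZero, coeff_rescale, coeff_mk, iteratedDeriv_comp_const_mul (hf n),
    mul_zero, mul_div_assoc]

theorem taylorAtZero_sin : taylorAtZero Real.sin = PowerSeries.sin ℝ := by
  ext n
  rcases Nat.even_or_odd' n with ⟨m, rfl | rfl⟩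
  · simp [taylorAtZero, PowerSeries.sin]
  · have h : (2 * m + 1) / 2 = m := by omega
    simp [taylorAtZero, PowerSeries.sin, h]

theorem taylorAtZero_cos : taylorAtZero Real.cos = PowerSeries.cos ℝ := by
  ext n
  rcases Nat.even_or_odd' n with ⟨m, rfl | rfl⟩
  · simp [taylorAtZero, PowerSeries.cos]
  · simp [taylorAtZero, PowerSeries.cos]

end PowerSeries

theorem Real.contDiffAt_Gamma {q : ℝ} (hq : ∀ m : ℕ, q ≠ -m) (n : ℕ) :
    ContDiffAt ℝ n Real.Gamma q := by
  have hne : (Complex.Gamma q)⁻¹ ≠ 0 :=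
    inv_ne_zero (Complex.Gamma_ne_zero fun m => by exact_mod_cast hq m)
  have h : ContDiffAt ℂ n Complex.Gamma q := by
    have h := (Complex.differentiable_one_div_Gamma.contDiff.contDiffAt (n := n)).inv hne
    rwa [show (fun s : ℂ => (Complex.Gamma s)⁻¹)⁻¹ = Complex.Gamma from
      funext fun s => inv_inv (Complex.Gamma s)] at h
  simpa [Complex.Gamma_ofReal] using h.real_of_complex

theorem Real.contDiffAt_Gamma_const_add {q : ℝ} (hq : ∀ m : ℕ, q ≠ -m) (n : ℕ) :
    ContDiffAt ℝ n (fun t => Real.Gamma (q + t)) 0 := by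
  refine ContDiffAt.comp (g := Real.Gamma) (0 : ℝ) ?_ (by fun_prop)
  simpa using Real.contDiffAt_Gamma hq n

theorem Real.contDiffAt_Gamma_const_sub {q : ℝ} (hq : ∀ m : ℕ, q ≠ -m) (n : ℕ) :
    ContDiffAt ℝ n (fun t => Real.Gamma (q - t)) 0 := by
  refine ContDiffAt.comp (g := Real.Gamma) (0 : ℝ) ?_ (by fun_prop)
  simpa using Real.contDiffAt_Gamma hq n

namespace PowerSeries

/-- The Taylor series at `t = 0` of `Γ(q + t) Γ(q - t)`. -/
noncomputable def gammaProduct (q : ℝ) : ℝ⟦X⟧ :=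
  taylorAtZero fun t => Real.Gamma (q + t) * Real.Gamma (q - t)

theorem coeff_gammaProduct {q : ℝ} (hq : ∀ m : ℕ, q ≠ -m) (j : ℕ) :
    coeff (2 * j) (gammaProduct q) = ∑ i ∈ Finset.range (2 * j + 1),
      (-1 : ℝ) ^ i * iteratedDeriv i Real.Gamma q * iteratedDeriv (2 * j - i) Real.Gamma q /
        ((Nat.factorial i : ℝ) * (Nat.factorial (2 * j - i) : ℝ)) := by
  rw [gammaProduct, taylorAtZero_mul (Real.contDiffAt_Gamma_const_add hq)
    (Real.contDiffAt_Gamma_const_sub hq),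
    mul_comm (taylorAtZero _) (taylorAtZero _), coeff_mul,
    Finset.Nat.sum_antidiagonal_eq_sum_range_succ_mk]
  refine Finset.sum_congr rfl fun i _ => ?_
  simp only [taylorAtZero, coeff_mk, iteratedDeriv_comp_const_add, iteratedDeriv_comp_const_sub,
    add_zero, sub_zero, smul_eq_mul]
  rw [div_mul_div_comm]

theorem gammaProduct_add_one {q : ℝ} (hq : ∀ m : ℕ, q ≠ -m) :
    gammaProduct (q + 1) = (C (q ^ 2) - X ^ 2) * gammaProduct q := by
  have h0 : q ≠ 0 := by simpa using hq 0
  have h : (fun t => Real.Gamma (q + 1 + t) * Real.Gamma (q + 1 - t)) =ᶠ[nhds 0]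
      fun t => ((q + t) * (q - t)) * (Real.Gamma (q + t) * Real.Gamma (q - t)) := by
    have h1 : ∀ᶠ t : ℝ in nhds 0, q + t ≠ 0 :=
      (by fun_prop : ContinuousAt (fun t : ℝ => q + t) 0).eventually_ne (by simpa using h0)
    have h2 : ∀ᶠ t : ℝ in nhds 0, q - t ≠ 0 :=
      (by fun_prop : ContinuousAt (fun t : ℝ => q - t) 0).eventually_ne (by simpa using h0)
    filter_upwards [h1, h2] with t h1 h2
    rw [add_right_comm, Real.Gamma_add_one h1, show q + 1 - t = q - t + 1 by ring,
      Real.Gamma_add_one h2]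
    ring
  rw [gammaProduct, taylorAtZero_congr h, taylorAtZero_mul (fun n => by fun_prop)
    (fun n => (Real.contDiffAt_Gamma_const_add hq n).mul (Real.contDiffAt_Gamma_const_sub hq n)),
    taylorAtZero_mul (fun n => by fun_prop) (fun n => by fun_prop), taylorAtZero_const_add,
    taylorAtZero_const_sub, ← gammaProduct, map_pow]
  ring

theorem gammaProduct_one :
    gammaProduct 1 = rescale π (map (algebraMap ℚ ℝ) sinc⁻¹) := by
  have h1 : ∀ m : ℕ, (1 : ℝ) ≠ -m := fun m => by
    have : (0 : ℝ) ≤ m := m.cast_nonneg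
    linarith
  have h : (fun t => Real.Gamma (1 + t) * Real.Gamma (1 - t) * Real.sin (π * t)) =ᶠ[nhds 0]
      fun t => π * (0 + t) := by
    have hlt : ∀ᶠ t : ℝ in nhds 0, |t| < 1 :=
      (by fun_prop : ContinuousAt (fun t : ℝ => |t|) 0).eventually_lt_const (by simp)
    filter_upwards [hlt] with t ht
    rcases eq_or_ne t 0 with rfl | h0
    · simp
    have hsin : Real.sin (π * t) ≠ 0 := by
      rw [Ne, Real.sin_eq_zero_iff]
      rintro ⟨n, hn⟩
      have hnt : (n : ℝ) = t := by
        rw [mul_comm] at hn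
        exact mul_left_cancel₀ Real.pi_ne_zero hn
      rw [← hnt, ← Int.cast_abs] at ht
      have : |n| < 1 := by exact_mod_cast ht
      rw [Int.abs_lt_one_iff] at this
      exact h0 (by rw [← hnt, this, Int.cast_zero])
    rw [add_comm 1 t, Real.Gamma_add_one h0, mul_assoc t, Real.Gamma_mul_Gamma_one_sub]
    rw [mul_assoc, div_mul_cancel₀ _ hsin, zero_add, mul_comm]
  have hT := taylorAtZero_congr h
  rw [taylorAtZero_mul (fun n => (Real.contDiffAt_Gamma_const_add h1 n).mul
      (Real.contDiffAt_Gamma_const_sub h1 n)) (fun n => by fun_prop), ← gammaProduct,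
    taylorAtZero_comp_const_mul (fun n => Real.contDiff_sin) π, taylorAtZero_sin,
    ← map_sin (algebraMap ℚ ℝ), ← X_mul_sinc, taylorAtZero_mul (fun n => by fun_prop)
    (fun n => by fun_prop), taylorAtZero_const, taylorAtZero_const_add, map_mul, map_mul,
    map_X, rescale_X, map_zero, zero_add] at hT
  have hX : (C π * X : ℝ⟦X⟧) ≠ 0 :=
    mul_ne_zero (by simp [Real.pi_ne_zero]) X_ne_zero
  have hS : gammaProduct 1 * rescale π (map (algebraMap ℚ ℝ) sinc) = 1 :=
    mul_left_cancel₀ hX (by linear_combination hT)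
  have hinv : rescale π (map (algebraMap ℚ ℝ) sinc) *
      rescale π (map (algebraMap ℚ ℝ) sinc⁻¹) = 1 := by
    rw [← map_mul, ← map_mul, PowerSeries.mul_inv_cancel _ (by simp [constantCoeff_sinc]),
      map_one, map_one]
  linear_combination rescale π (map (algebraMap ℚ ℝ) sinc⁻¹) * hS - gammaProduct 1 * hinv

theorem gammaProduct_one_half :
    gammaProduct (1 / 2) =
      C π * rescale π (map (algebraMap ℚ ℝ) (PowerSeries.cos ℚ)⁻¹) := by
  have h1 : ∀ m : ℕ, (1 / 2 : ℝ) ≠ -m := fun m => by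
    have : (0 : ℝ) ≤ m := m.cast_nonneg
    linarith
  have h : (fun t => Real.Gamma (1 / 2 + t) * Real.Gamma (1 / 2 - t) * Real.cos (π * t))
      =ᶠ[nhds 0] fun _ => π := by
    have hne : ∀ᶠ t : ℝ in nhds 0, Real.cos (π * t) ≠ 0 :=
      (by fun_prop : ContinuousAt (fun t : ℝ => Real.cos (π * t)) 0).eventually_ne (by simp)
    filter_upwards [hne] with t ht
    rw [show (1 / 2 - t : ℝ) = 1 - (1 / 2 + t) by ring, Real.Gamma_mul_Gamma_one_sub,
      show π * (1 / 2 + t) = π * t + π / 2 by ring, Real.sin_add_pi_div_two]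
    field_simp
  have hT := taylorAtZero_congr h
  rw [taylorAtZero_mul (fun n => (Real.contDiffAt_Gamma_const_add h1 n).mul
      (Real.contDiffAt_Gamma_const_sub h1 n)) (fun n => by fun_prop), ← gammaProduct,
    taylorAtZero_comp_const_mul (fun n => Real.contDiff_cos) π, taylorAtZero_cos,
    ← map_cos (algebraMap ℚ ℝ), taylorAtZero_const] at hT
  have hinv : rescale π (map (algebraMap ℚ ℝ) (PowerSeries.cos ℚ)) *
      rescale π (map (algebraMap ℚ ℝ) (PowerSeries.cos ℚ)⁻¹) = 1 := by
    rw [← map_mul, ← map_mul, PowerSeries.mul_inv_cancel _ (by simp [constantCoeff_cos]),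
      map_one, map_one]
  linear_combination rescale π (map (algebraMap ℚ ℝ) (PowerSeries.cos ℚ)⁻¹) * hT -
    gammaProduct (1 / 2) * hinv

/-- `f` is a rational power series with nonzero constant term times `K`. -/
def IsRationalUnitMultiple (K f : ℝ⟦X⟧) : Prop :=
  ∃ U : ℚ⟦X⟧, constantCoeff U ≠ 0 ∧ f = map (algebraMap ℚ ℝ) U * K

theorem isRationalUnitMultiple_gammaProduct_add_one_iff {K : ℝ⟦X⟧} {r : ℚ}
    (hr : ∀ m : ℕ, (r : ℝ) ≠ -m) :
    IsRationalUnitMultiple K (gammaProduct (r + 1)) ↔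
      IsRationalUnitMultiple K (gammaProduct r) := by
  have h0 : r ≠ 0 := by simpa using hr 0
  set P : ℚ⟦X⟧ := C (r ^ 2) - X ^ 2 with hP
  have hP0 : constantCoeff P ≠ 0 := by simp [hP, h0]
  have hrec : gammaProduct (r + 1) = map (algebraMap ℚ ℝ) P * gammaProduct r := by
    rw [gammaProduct_add_one hr]
    simp [hP]
  constructor
  · rintro ⟨U, hU, h⟩
    refine ⟨P⁻¹ * U, by simpa [hU] using hP0, ?_⟩
    have hinv : map (algebraMap ℚ ℝ) P⁻¹ * map (algebraMap ℚ ℝ) P = 1 := by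
      rw [← map_mul, PowerSeries.inv_mul_cancel _ hP0, map_one]
    rw [map_mul, mul_assoc, ← h, hrec, ← mul_assoc, hinv, one_mul]
  · rintro ⟨U, hU, h⟩
    refine ⟨P * U, by simpa [hU] using hP0, ?_⟩
    rw [hrec, h, map_mul, mul_assoc]

theorem isRationalUnitMultiple_gammaProduct_nat (n : ℕ) :
    IsRationalUnitMultiple (rescale π (map (algebraMap ℚ ℝ) sinc⁻¹))
      (gammaProduct ((n : ℝ) + 1)) := by
  induction n with
  | zero => exact ⟨1, by simp, by simp [gammaProduct_one]⟩
  | succ n ih =>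
    have h := (isRationalUnitMultiple_gammaProduct_add_one_iff (r := (n : ℚ) + 1)
      (K := rescale π (map (algebraMap ℚ ℝ) sinc⁻¹)) (fun m => ?_)).2
    · push_cast at h ⊢
      exact h ih
    · have h1 : (0 : ℝ) ≤ n := n.cast_nonneg
      have h2 : (0 : ℝ) ≤ m := m.cast_nonneg
      push_cast
      linarith

theorem isRationalUnitMultiple_gammaProduct_half (k : ℤ) :
    IsRationalUnitMultiple
      (C π * rescale π (map (algebraMap ℚ ℝ) (PowerSeries.cos ℚ)⁻¹))
      (gammaProduct ((k : ℝ) + 1 / 2)) := by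
  have hne (k : ℤ) (m : ℕ) : (((k : ℚ) + 1 / 2 : ℚ) : ℝ) ≠ -m := fun h => by
    have h' : (k : ℚ) + 1 / 2 = -m := by exact_mod_cast h
    have : (2 * k + 1 : ℤ) = -2 * m := by
      have : (2 * k + 1 : ℚ) = -2 * m := by linarith
      exact_mod_cast this
    omega
  have hstep (k : ℤ) := isRationalUnitMultiple_gammaProduct_add_one_iff (hne k)
    (K := C π * rescale π (map (algebraMap ℚ ℝ) (PowerSeries.cos ℚ)⁻¹))
  induction k using Int.induction_on with
  | zero => exact ⟨1, by simp, by simpa using gammaProduct_one_half⟩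
  | succ k ih =>
    have h := (hstep k).2
    push_cast at h ih ⊢
    rw [add_right_comm]
    exact h ih
  | pred k ih =>
    have h := (hstep (-k - 1)).1
    push_cast at h ih ⊢
    refine h ?_
    convert ih using 2
    ring

theorem sum_range_eq_sum_even {F : ℕ → ℝ} (hF : ∀ n, Odd n → F n = 0) (j : ℕ) :
    ∑ n ∈ Finset.range (2 * j + 1), F n = ∑ k ∈ Finset.range (j + 1), F (2 * k) := by
  induction j with
  | zero => simp
  | succ j ih =>
    rw [Finset.sum_range_succ _ (j + 1), ← ih, show 2 * (j + 1) + 1 = 2 * j + 1 + 1 + 1 by ring,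
      Finset.sum_range_succ, Finset.sum_range_succ, hF (2 * j + 1) ⟨j, rfl⟩, add_zero]
    rfl

/-- The even coefficients of a rational unit multiple of `π ^ ε * V(π X)`, with `V` even and
rational with nonzero even coefficients, as combinations of powers of `π`. -/
theorem IsRationalUnitMultiple.exists_coeff_eq {V : ℚ⟦X⟧} {f : ℝ⟦X⟧} {ε : ℕ}
    (hf : IsRationalUnitMultiple (C (π ^ ε) * rescale π (map (algebraMap ℚ ℝ) V)) f)
    (hV : evalNegHom V = V) (j : ℕ) (hj : coeff (2 * j) V ≠ 0) :
    ∃ e : ℕ → ℝ, (∀ k ≤ j, IsAlgebraic ℚ (e k)) ∧ e j ≠ 0 ∧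
      coeff (2 * j) f = ∑ k ∈ Finset.range (j + 1), e k * π ^ (2 * k + ε) := by
  obtain ⟨U, hU, rfl⟩ := hf
  refine ⟨fun k => algebraMap ℚ ℝ (coeff (2 * j - 2 * k) U * coeff (2 * k) V),
    fun k _ => isAlgebraic_algebraMap _, ?_, ?_⟩
  · simpa using ⟨hU, hj⟩
  rw [mul_comm (map _ U), mul_assoc, coeff_C_mul, coeff_mul,
    Finset.Nat.sum_antidiagonal_eq_sum_range_succ_mk, sum_range_eq_sum_even, Finset.mul_sum]
  · refine Finset.sum_congr rfl fun k _ => ?_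
    simp only [coeff_rescale, coeff_map, map_mul]
    ring
  · intro n hn
    simp [coeff_eq_zero_of_evalNegHom_eq hV hn]

end PowerSeries

/-- For `q` with `2q ∈ ℤ`, `q` not a nonpositive integer, with `ε = 0` if `q ∈ ℤ` and
`ε = 1` otherwise: the `(2j)`-th Taylor coefficient of `Γ(q+t)Γ(q−t)` is an algebraic
linear combination of `π^ε, π^(2+ε), …, π^(2j+ε)` with nonzero top coefficient. -/
theorem gamma_product_coeff_pi_expansion
    (q : ℝ) (hq : ∃ k : ℤ, 2 * q = (k : ℝ))
    (hq' : ¬ ∃ k : ℤ, k ≤ 0 ∧ q = (k : ℝ))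
    (ε : ℕ) (hε : ε = if ∃ k : ℤ, q = (k : ℝ) then 0 else 1) (j : ℕ) :
    ∃ e : ℕ → ℝ, (∀ k ≤ j, IsAlgebraic ℚ (e k)) ∧ e j ≠ 0 ∧
      (∑ i ∈ Finset.range (2 * j + 1),
          (-1 : ℝ) ^ i * iteratedDeriv i Real.Gamma q * iteratedDeriv (2 * j - i) Real.Gamma q /
            ((Nat.factorial i : ℝ) * (Nat.factorial (2 * j - i) : ℝ))) =
        ∑ k ∈ Finset.range (j + 1), e k * π ^ (2 * k + ε) := by
  have hpole : ∀ m : ℕ, q ≠ -m := fun m h => hq' ⟨-m, by simp, by simp [h]⟩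
  rw [← PowerSeries.coeff_gammaProduct hpole]
  by_cases hint : ∃ k : ℤ, q = k
  · rw [if_pos hint] at hε
    obtain ⟨k, hk⟩ := hint
    have hkpos : 0 < k := not_le.1 fun h => hq' ⟨k, h, hk⟩
    obtain ⟨n, rfl⟩ : ∃ n : ℕ, k = n + 1 := ⟨(k - 1).toNat, by omega⟩
    refine PowerSeries.IsRationalUnitMultiple.exists_coeff_eq (V := PowerSeries.sinc⁻¹) ?_
      (PowerSeries.evalNegHom_inv (by simp [PowerSeries.constantCoeff_sinc])
        PowerSeries.evalNegHom_sinc) j (PowerSeries.coeff_even_inv_sinc_pos j).ne'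
    simpa [hε, hk] using PowerSeries.isRationalUnitMultiple_gammaProduct_nat n
  · rw [if_neg hint] at hε
    obtain ⟨k, hk⟩ := hq
    rcases Int.even_or_odd' k with ⟨m, rfl | rfl⟩
    · exact absurd ⟨m, by push_cast at hk; linarith⟩ hint
    have hqm : q = (m : ℝ) + 1 / 2 := by push_cast at hk; linarith
    refine PowerSeries.IsRationalUnitMultiple.exists_coeff_eq (V := (PowerSeries.cos ℚ)⁻¹) ?_
      (PowerSeries.evalNegHom_inv (by simp [PowerSeries.constantCoeff_cos])
        PowerSeries.evalNegHom_cos) j (PowerSeries.coeff_even_inv_cos_pos j).ne'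
    rw [hε, hqm, pow_one]
    exact PowerSeries.isRationalUnitMultiple_gammaProduct_half m
end
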